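/- Let C = (c_0, …, c_n) with n ≥ 2 be a 1D crease pattern that is an end sequence, i.e., its interval lengths read left to right first weakly increase and then weakly decrease (equivalently, C contains no crimpable sequence), and let μ be any MV assignment on C. Then every forcing set of (C, μ) contains every crease of C; i.e., the only forcing set of (C, μ) is the set of all creases {c_1, …, c_{n−1}}. -/

import Mathlib

/-- Mountain or valley label for a crease. -/
inductive MV : Type
  | M : MV
  | V : MV
deriving DecidableEq

/-- `(c 0, c 1, …, c n)` is a 1D crease pattern: a strictly increasing finite
sequence of reals with `n ≥ 1`.  The points `c 1, …, c (n-1)` are its creases,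
`c 0` and `c n` its ends. -/
def IsCreasePattern (n : ℕ) (c : ℕ → ℝ) : Prop :=
  1 ≤ n ∧ ∀ i j : ℕ, i < j → j ≤ n → c i < c j

/-- The consecutive creases `(c i, …, c (i+k))` form a crimpable sequence with gap `d`. -/
def IsCrimpable (n : ℕ) (c : ℕ → ℝ) (i k : ℕ) (d : ℝ) : Prop :=
  1 ≤ i ∧ 1 ≤ k ∧ i + k ≤ n - 1 ∧
  (∀ m : ℕ, i ≤ m → m < i + k → c (m + 1) - c m = d) ∧
  d < c i - c (i - 1) ∧ d < c (i + k + 1) - c (i + k)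

/-- Additive offset of the folded-position map on the `j`-th interval:
on `[c j, c (j+1)]` the folded-position map is `x ↦ (-1)^j * x + foldOffset c j`. -/
def foldOffset (c : ℕ → ℝ) : ℕ → ℝ
  | 0 => 0
  | j + 1 => foldOffset c (j) + 2 * (-1 : ℝ) ^ j * c (j + 1)

/-- Folded position of a point `x` belonging to the `j`-th interval `[c j, c (j+1)]`.
This is the unique continuous map equal to the identity on `[c 0, c 1]`, isometric on
every interval, and reversing direction at every crease. -/
def foldPos (c : ℕ → ℝ) (j : ℕ) (x : ℝ) : ℝ := (-1 : ℝ) ^ j * x + foldOffset c j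

/-- Folded position of the crease `c i`. -/
def foldCrease (c : ℕ → ℝ) (i : ℕ) : ℝ := foldPos c i (c i)

/-- `x` lies strictly `lt`-between `a` and `b`. -/
def Between (lt : ℕ → ℕ → Prop) (a b x : ℕ) : Prop :=
  (lt a x ∧ lt x b) ∨ (lt b x ∧ lt x a)

/-- The MV pattern `(C, μ)` is flat-foldable: there is a strict linear order `lt`
("strictly below") on the intervals `I_0, …, I_{n-1}` (indexed `0, …, n-1`) such that:
(i) for each crease `i`, `I_{i-1}` is below `I_i` iff either `μ i = V` and the folded map
is increasing on `I_{i-1}` (slope `(-1)^(i-1) = 1`), or `μ i = M` and it is decreasing;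
(ii) for each crease `i` and each interval `J` whose folded image contains the folded
crease position in its interior, `J` is not strictly between `I_{i-1}` and `I_i`;
(iii) for distinct creases `i, j` folding to the same point, it is not the case that
exactly one of `I_{j-1}`, `I_j` is strictly between `I_{i-1}` and `I_i`. -/
def IsFlatFoldable (n : ℕ) (c : ℕ → ℝ) (μ : ℕ → MV) : Prop :=
  ∃ lt : ℕ → ℕ → Prop,
    (∀ j, j < n → ¬ lt j j) ∧
    (∀ a b e, lt a b → lt b e → lt a e) ∧
    (∀ a b, a < n → b < n → a ≠ b → lt a b ∨ lt b a) ∧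
    (∀ a b, lt a b → a < n ∧ b < n) ∧
    (∀ i, 1 ≤ i → i ≤ n - 1 →
      (lt (i - 1) i ↔ ((μ i = MV.V ∧ Even (i - 1)) ∨ (μ i = MV.M ∧ Odd (i - 1))))) ∧
    (∀ i, 1 ≤ i → i ≤ n - 1 → ∀ j, j < n →
      foldCrease c i ∈
        Set.Ioo (min (foldPos c j (c j)) (foldPos c j (c (j + 1))))
                (max (foldPos c j (c j)) (foldPos c j (c (j + 1)))) →
      ¬ Between lt (i - 1) i j) ∧
    (∀ i j, 1 ≤ i → i ≤ n - 1 → 1 ≤ j → j ≤ n - 1 → i ≠ j →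
      foldCrease c i = foldCrease c j →
      (Between lt (i - 1) i (j - 1) ↔ Between lt (i - 1) i j))

/-- `F` is a forcing set for the MV pattern `(C, μ)`: a set of creases such that the only
flat-foldable assignment agreeing with `μ` on `F` is `μ` itself (on all creases). -/
def IsForcingSet (n : ℕ) (c : ℕ → ℝ) (μ : ℕ → MV) (F : Set ℕ) : Prop :=
  F ⊆ Set.Icc 1 (n - 1) ∧
  ∀ ν : ℕ → MV, IsFlatFoldable n c ν → (∀ x ∈ F, ν x = μ x) →
    ∀ x, 1 ≤ x → x ≤ n - 1 → ν x = μ x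

/-- The crease pattern produced by a monocrimp at the adjacent pair `(c j, c (j+1))`:
it deletes `c j` and `c (j+1)` and translates all later points by `-2 * (c (j+1) - c j)`. -/
def monocrimpPattern (c : ℕ → ℝ) (j : ℕ) : ℕ → ℝ :=
  fun x => if x < j then c x else c (x + 2) - 2 * (c (j + 1) - c j)

/-- The folded image of an interval ends at the folded position of the next crease. -/
lemma foldPos_succ_right (c : ℕ → ℝ) (j : ℕ) :
    foldPos c j (c (j + 1)) = foldCrease c (j + 1) := by
  simp only [foldCrease, foldPos, foldOffset]
  ring

lemma foldCrease_succ (c : ℕ → ℝ) (j : ℕ) :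
    foldCrease c (j + 1) = foldCrease c j + (-1) ^ j * (c (j + 1) - c j) := by
  simp only [foldCrease, foldPos, foldOffset]
  ring

lemma foldCrease_succ_ne (c : ℕ → ℝ) (j : ℕ) (h : c j < c (j + 1)) :
    foldCrease c (j + 1) ≠ foldCrease c j := by
  rw [foldCrease_succ]
  rcases neg_one_pow_eq_or ℝ j with hs | hs <;> rw [hs] <;> intro h' <;> linarith

/-- The folded image of the `j`-th interval. -/
def foldImage (c : ℕ → ℝ) (j : ℕ) : Set ℝ := Set.uIcc (foldCrease c j) (foldCrease c (j + 1))

lemma foldImage_subset_succ (c : ℕ → ℝ) (j : ℕ) (h₀ : c j ≤ c (j + 1))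
    (h : c (j + 1) - c j ≤ c (j + 2) - c (j + 1)) :
    foldImage c j ⊆ foldImage c (j + 1) := by
  have e₁ := foldCrease_succ c j
  have e₂ := foldCrease_succ c (j + 1)
  rw [pow_succ] at e₂
  refine Set.uIcc_subset_uIcc ?_ Set.left_mem_uIcc
  rw [Set.mem_uIcc]
  rcases neg_one_pow_eq_or ℝ j with hs | hs <;> rw [hs] at e₁ e₂
  · right; constructor <;> linarith
  · left; constructor <;> linarith

lemma foldImage_succ_subset (c : ℕ → ℝ) (j : ℕ) (h₀ : c (j + 1) ≤ c (j + 2))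
    (h : c (j + 2) - c (j + 1) ≤ c (j + 1) - c j) :
    foldImage c (j + 1) ⊆ foldImage c j := by
  have e₁ := foldCrease_succ c j
  have e₂ := foldCrease_succ c (j + 1)
  rw [pow_succ] at e₂
  refine Set.uIcc_subset_uIcc Set.right_mem_uIcc ?_
  rw [Set.mem_uIcc]
  rcases neg_one_pow_eq_or ℝ j with hs | hs <;> rw [hs] at e₁ e₂
  · left; constructor <;> linarith
  · right; constructor <;> linarith

lemma notMem_Ioo_of_foldImage_subset {c : ℕ → ℝ} {k m : ℕ} (h : foldImage c k ⊆ foldImage c m)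
    {x : ℝ} (hx : x = foldCrease c m ∨ x = foldCrease c (m + 1)) :
    x ∉ Set.Ioo (min (foldPos c k (c k)) (foldPos c k (c (k + 1))))
      (max (foldPos c k (c k)) (foldPos c k (c (k + 1)))) := by
  rw [foldPos_succ_right]
  change x ∉ Set.Ioo (min (foldCrease c k) _) (max (foldCrease c k) _)
  have h' := Set.uIcc_subset_uIcc_iff_le.mp h
  rintro ⟨h₁, h₂⟩
  have h₃ := h'.1.trans_lt h₁
  have h₄ := h₂.trans_le h'.2
  rcases hx with rfl | rfl
  · rcases le_total (foldCrease c m) (foldCrease c (m + 1)) with hm | hm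
    · simp [hm] at h₃
    · simp [hm] at h₄
  · rcases le_total (foldCrease c m) (foldCrease c (m + 1)) with hm | hm
    · simp [hm] at h₄
    · simp [hm] at h₃

/-- Weights of the creases: distinct powers of three, increasing up to the `p`-th crease,
decreasing afterwards, and larger to the right of the `p`-th interval than to its left. -/
def creaseWeight (n p j : ℕ) : ℤ := if j ≤ p then 3 ^ j else 3 ^ (2 * n - j)

open Classical in
/-- The change of height at a crease, positive exactly at the creases satisfying `e`. -/
noncomputable def heightStep (n p : ℕ) (e : ℕ → Prop) (j : ℕ) : ℤ :=
  if e j then creaseWeight n p j else -creaseWeight n p j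

/-- The height at which an interval is placed in the stack. -/
noncomputable def height (n p : ℕ) (e : ℕ → Prop) (k : ℕ) : ℤ :=
  ∑ j ∈ Finset.range k, heightStep n p e (j + 1)

lemma height_succ (n p : ℕ) (e : ℕ → Prop) (k : ℕ) :
    height n p e (k + 1) = height n p e k + heightStep n p e (k + 1) :=
  Finset.sum_range_succ _ _

lemma abs_heightStep (n p : ℕ) (e : ℕ → Prop) (j : ℕ) :
    |heightStep n p e j| = creaseWeight n p j := by
  have : 0 ≤ creaseWeight n p j := by unfold creaseWeight; split_ifs <;> positivity
  unfold heightStep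
  split_ifs <;> simp [abs_of_nonneg this]

lemma two_mul_abs_height_sub_lt_left (n p : ℕ) (e : ℕ → Prop) {a b : ℕ} (hab : a ≤ b)
    (hb : b ≤ p) : 2 * |height n p e b - height n p e a| < 3 ^ (b + 1) := by
  induction b, hab using Nat.le_induction with
  | base => simp
  | succ b hab ih =>
    have h₁ := ih (by omega)
    have h₂ := abs_heightStep n p e (b + 1)
    rw [creaseWeight, if_pos hb] at h₂
    have h₃ := abs_add_le (height n p e b - height n p e a) (heightStep n p e (b + 1))
    rw [height_succ, add_sub_right_comm, pow_succ 3 (b + 1)]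
    linarith

lemma two_mul_abs_height_sub_lt_right (n p : ℕ) (e : ℕ → Prop) {a b : ℕ} (hab : a ≤ b)
    (ha : p ≤ a) (hb : b ≤ n) : 2 * |height n p e b - height n p e a| < 3 ^ (2 * n - a) := by
  induction hab using Nat.decreasingInduction with
  | self => simp
  | of_succ a hab ih =>
    have h₁ := ih (by omega)
    have h₂ := abs_heightStep n p e (a + 1)
    rw [creaseWeight, if_neg (by omega)] at h₂
    have h₃ := abs_add_le (height n p e b - height n p e (a + 1)) (heightStep n p e (a + 1))
    have h₄ : height n p e b - height n p e a
        = height n p e b - height n p e (a + 1) + heightStep n p e (a + 1) := by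
      rw [height_succ]; ring
    rw [h₄, show 2 * n - a = 2 * n - (a + 1) + 1 by omega, pow_succ]
    linarith

/-- The crease of largest weight strictly between the `a`-th and the `b`-th interval. -/
def dominantCrease (p a b : ℕ) : ℕ := if b ≤ p then b else max a p + 1

lemma abs_height_sub_sub_lt (n p : ℕ) (e : ℕ → Prop) {a b : ℕ} (hab : a < b) (hb : b < n)
    (hp : p < n) :
    |height n p e b - height n p e a - heightStep n p e (dominantCrease p a b)|
      < creaseWeight n p (dominantCrease p a b) := by
  unfold dominantCrease
  split_ifs with hbp
  · obtain ⟨b, rfl⟩ : ∃ b', b = b' + 1 := ⟨b - 1, by omega⟩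
    have h := two_mul_abs_height_sub_lt_left n p e (show a ≤ b by omega) (by omega)
    rw [height_succ, creaseWeight, if_pos hbp, add_sub_right_comm, add_sub_cancel_right]
    have := abs_nonneg (height n p e b - height n p e a)
    linarith
  · have h₁ := two_mul_abs_height_sub_lt_right n p e (show max a p + 1 ≤ b by omega)
      (by omega) hb.le
    have h₂ : 2 * |height n p e (max a p) - height n p e a| < 3 ^ (2 * n - (max a p + 1)) := by
      rcases le_total a p with hap | hap
      · rw [max_eq_right hap]
        exact (two_mul_abs_height_sub_lt_left n p e hap le_rfl).trans_le
          (pow_le_pow_right₀ (by norm_num) (by omega))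
      · simp [max_eq_left hap]
    rw [creaseWeight, if_neg (by omega)]
    have h₃ := abs_add_le (height n p e b - height n p e (max a p + 1))
      (height n p e (max a p) - height n p e a)
    have h₄ : height n p e b - height n p e a - heightStep n p e (max a p + 1)
        = height n p e b - height n p e (max a p + 1)
          + (height n p e (max a p) - height n p e a) := by
      rw [height_succ]; ring
    rw [h₄]
    linarith

lemma height_lt_of_dominant (n p : ℕ) (e : ℕ → Prop) {a b : ℕ} (hab : a < b) (hb : b < n)
    (hp : p < n) (he : e (dominantCrease p a b)) : height n p e a < height n p e b := by
  have h := abs_lt.mp (abs_height_sub_sub_lt n p e hab hb hp)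
  rw [heightStep, if_pos he] at h
  linarith [h.1]

lemma height_lt_of_not_dominant (n p : ℕ) (e : ℕ → Prop) {a b : ℕ} (hab : a < b) (hb : b < n)
    (hp : p < n) (he : ¬ e (dominantCrease p a b)) : height n p e b < height n p e a := by
  have h := abs_lt.mp (abs_height_sub_sub_lt n p e hab hb hp)
  rw [heightStep, if_neg he] at h
  linarith [h.2]

/-- Every MV assignment on an end sequence is flat-foldable. -/
theorem isFlatFoldable_of_end_sequence (n : ℕ) (c : ℕ → ℝ) (hC : IsCreasePattern n c)
    (hEnd : ∃ p, p < n ∧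
      (∀ j, j < p → c (j + 1) - c j ≤ c (j + 2) - c (j + 1)) ∧
      (∀ j, p ≤ j → j + 1 < n → c (j + 2) - c (j + 1) ≤ c (j + 1) - c j))
    (ν : ℕ → MV) : IsFlatFoldable n c ν := by
  obtain ⟨p, hp, hinc, hdec⟩ := hEnd
  have hc : ∀ j, j < n → c j < c (j + 1) := fun j hj => hC.2 j (j + 1) (by omega) (by omega)
  have nestL : ∀ k m, k ≤ m → m ≤ p → foldImage c k ⊆ foldImage c m := by
    intro k m hkm
    induction m, hkm using Nat.le_induction with
    | base => exact fun _ => subset_rfl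
    | succ m _ ih =>
      exact fun hm => (ih (by omega)).trans
        (foldImage_subset_succ c m (hc m (by omega)).le (hinc m (by omega)))
  have nestR : ∀ m k, m ≤ k → p ≤ m → k < n → foldImage c k ⊆ foldImage c m := by
    intro m k hmk hm
    induction k, hmk using Nat.le_induction with
    | base => exact fun _ => subset_rfl
    | succ k _ ih =>
      exact fun hk => (foldImage_succ_subset c k (hc (k + 1) hk).le
        (hdec k (by omega) hk)).trans (ih (by omega))
  set e : ℕ → Prop := fun i => (ν i = MV.V ∧ Even (i - 1)) ∨ (ν i = MV.M ∧ Odd (i - 1)) with he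
  clear_value e
  set lt : ℕ → ℕ → Prop := fun a b => a < n ∧ b < n ∧ height n p e a < height n p e b with hlt
  have up : ∀ a b, a < b → b < n → (lt a b ↔ e (dominantCrease p a b)) := by
    intro a b hab hb
    by_cases h : e (dominantCrease p a b)
    · simp [hlt, h, hb, hab.trans hb, height_lt_of_dominant n p e hab hb hp h]
    · simp [hlt, h, (height_lt_of_not_dominant n p e hab hb hp h).le]
  have down : ∀ a b, a < b → b < n → (lt b a ↔ ¬ e (dominantCrease p a b)) := by
    intro a b hab hb
    by_cases h : e (dominantCrease p a b)
    · simp [hlt, h, (height_lt_of_dominant n p e hab hb hp h).le]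
    · simp [hlt, h, hb, hab.trans hb, height_lt_of_not_dominant n p e hab hb hp h]
  have irrefl : ∀ j, ¬ lt j j := fun j h => lt_irrefl _ h.2.2
  clear_value lt
  have below : ∀ i k, i < n → k < i - 1 → (Between lt (i - 1) i k ↔
      i ≤ p + 1 ∧ ((e i ∧ ¬ e (i - 1)) ∨ (¬ e i ∧ e (i - 1)))) := by
    intro i k hi hk
    have h₁ := up k i (by omega) hi
    have h₂ := down k i (by omega) hi
    have h₃ := up k (i - 1) (by omega) (by omega)
    have h₄ := down k (i - 1) (by omega) (by omega)
    rw [Between, h₁, h₂, h₃, h₄]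
    by_cases h : i ≤ p + 1
    · rw [show dominantCrease p k i = i by unfold dominantCrease; split_ifs <;> omega,
        show dominantCrease p k (i - 1) = i - 1 by unfold dominantCrease; split_ifs <;> omega]
      tauto
    · rw [show dominantCrease p k (i - 1) = dominantCrease p k i by
        unfold dominantCrease; split_ifs <;> omega]
      tauto
  have above : ∀ i k, 1 ≤ i → k < n → i < k → (Between lt (i - 1) i k ↔
      p < i ∧ ((e i ∧ ¬ e (i + 1)) ∨ (¬ e i ∧ e (i + 1)))) := by
    intro i k hi hk hik
    rw [Between, up i k hik hk, down i k hik hk, up (i - 1) k (by omega) hk,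
      down (i - 1) k (by omega) hk]
    by_cases h : p < i
    · rw [show dominantCrease p i k = i + 1 by unfold dominantCrease; split_ifs <;> omega,
        show dominantCrease p (i - 1) k = i by unfold dominantCrease; split_ifs <;> omega]
      tauto
    · rw [show dominantCrease p (i - 1) k = dominantCrease p i k by
        unfold dominantCrease; split_ifs <;> omega]
      tauto
  refine ⟨lt, fun j _ => irrefl j, ?_, ?_, ?_, ?_, ?_, ?_⟩
  · subst hlt
    exact fun a b d h₁ h₂ => ⟨h₁.1, h₂.2.1, h₁.2.2.trans h₂.2.2⟩
  · intro a b ha hb hab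
    rcases lt_or_gt_of_ne hab with h | h
    · rw [up a b h hb, down a b h hb]
      exact em _
    · rw [up b a h ha, down b a h ha]
      exact (em _).symm
  · subst hlt
    exact fun a b h => ⟨h.1, h.2.1⟩
  · intro i hi hin
    rw [up (i - 1) i (by omega) (by omega),
      show dominantCrease p (i - 1) i = i by unfold dominantCrease; split_ifs <;> omega, he]
  · intro i hi hin j hj hmem hbet
    rcases lt_trichotomy j (i - 1) with h | rfl | h
    · have hip := ((below i j (by omega) h).mp hbet).1
      refine notMem_Ioo_of_foldImage_subset (nestL j (i - 1) h.le (by omega)) ?_ hmem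
      rw [Nat.sub_add_cancel hi]
      exact Or.inr rfl
    · rcases hbet with h | h
      · exact irrefl _ h.1
      · exact irrefl _ h.2
    · rcases (show i ≤ j by omega).eq_or_lt with rfl | h'
      · rcases hbet with h | h
        · exact irrefl _ h.2
        · exact irrefl _ h.1
      · have hip := ((above i j hi hj h').mp hbet).1
        exact notMem_Ioo_of_foldImage_subset (nestR i j h'.le hip.le hj) (Or.inl rfl) hmem
  · intro i j hi hin hj hjn hij hfold
    have h₁ : j ≠ i + 1 := by
      rintro rfl
      exact foldCrease_succ_ne c i (hc i (by omega)) hfold.symm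
    have h₂ : i ≠ j + 1 := by
      rintro rfl
      exact foldCrease_succ_ne c j (hc j (by omega)) hfold
    rcases lt_or_gt_of_ne hij with h | h
    · rw [above i j hi (by omega) h, above i (j - 1) hi (by omega) (by omega)]
    · rw [below i j (by omega) (by omega), below i (j - 1) (by omega) (by omega)]

/-- If the crease pattern `C = (c 0, …, c n)` with `n ≥ 2` is an end sequence — its
interval lengths first weakly increase and then weakly decrease — then, for any MV
assignment `μ`, every forcing set of `(C, μ)` contains every crease of `C`; i.e. the
only forcing set is the set of all creases `{1, …, n-1}`. -/
theorem end_sequence_forcing_set_is_everything (n : ℕ) (c : ℕ → ℝ)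
    (hn : 2 ≤ n) (hC : IsCreasePattern n c)
    (hEnd : ∃ p, p < n ∧
      (∀ j, j < p → c (j + 1) - c j ≤ c (j + 2) - c (j + 1)) ∧
      (∀ j, p ≤ j → j + 1 < n → c (j + 2) - c (j + 1) ≤ c (j + 1) - c j))
    (μ : ℕ → MV) (hF : IsFlatFoldable n c μ) :
    ∀ F : Set ℕ, IsForcingSet n c μ F → ∀ x, 1 ≤ x → x ≤ n - 1 → x ∈ F := by
  intro F hforce x hx hxn
  by_contra hxF
  have hflip : ∃ y : MV, y ≠ μ x := by
    cases μ x
    · exact ⟨MV.V, by simp⟩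
    · exact ⟨MV.M, by simp⟩
  obtain ⟨y, hy⟩ := hflip
  have h := hforce.2 (Function.update μ x y) (isFlatFoldable_of_end_sequence n c hC hEnd _)
    (fun z hz => Function.update_of_ne (ne_of_mem_of_not_mem hz hxF) _ _) x hx hxn
  rw [Function.update_self] at h
  exact hy h
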